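/- arXiv:1508.06510 — 5 statements merged into one kernel-verified Lean document; each statement's English description precedes it below -/
import Mathlib

section
/- Let a, b, c, d, k ∈ ℂ with a·d − b·c ≠ 0, k ≠ 0 and k ≠ 1. Suppose that for every z ∈ ℂ with c·k·z + d ≠ 0 and c·z + d ≠ 0 one has k·((a·k·z + b)/(c·k·z + d)) = (a·z + b)/(c·z + d). Then b·d = 0 and a·c = 0, and moreover a·d = 0 or k = −1. -/
open Polynomial in
/-- A quadratic that vanishes wherever two nonzero linear polynomials do not has zero
coefficients. -/
theorem quadratic_coeffs_eq_zero_of_forall_linear_ne_zero {K : Type*} [Field K] [Infinite K]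
    {p q r c₁ d₁ c₂ d₂ : K} (h₁ : c₁ ≠ 0 ∨ d₁ ≠ 0) (h₂ : c₂ ≠ 0 ∨ d₂ ≠ 0)
    (h : ∀ z : K, c₁ * z + d₁ ≠ 0 → c₂ * z + d₂ ≠ 0 → p * z ^ 2 + q * z + r = 0) :
    p = 0 ∧ q = 0 ∧ r = 0 := by
  have linear_ne_zero : ∀ {c d : K}, c ≠ 0 ∨ d ≠ 0 → (C c * X + C d : K[X]) ≠ 0 := by
    intro c d hcd h0
    have hd := congrArg (fun f => coeff f 0) h0
    have hc := congrArg (fun f => coeff f 1) h0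
    simp [coeff_C] at hc hd
    simp_all
  have hprod : (C c₁ * X + C d₁) * (C c₂ * X + C d₂) * (C p * X ^ 2 + C q * X + C r) = 0 := by
    refine Polynomial.funext fun z => ?_
    simp only [eval_mul, eval_add, eval_C, eval_X, eval_pow, eval_zero]
    by_cases hz₁ : c₁ * z + d₁ = 0
    · simp [hz₁]
    by_cases hz₂ : c₂ * z + d₂ = 0
    · simp [hz₂]
    simp [h z hz₁ hz₂]
  have hquad := (mul_eq_zero.1 hprod).resolve_left
    (mul_ne_zero (linear_ne_zero h₁) (linear_ne_zero h₂))
  have hp := congrArg (fun f => coeff f 2) hquad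
  have hq := congrArg (fun f => coeff f 1) hquad
  have hr := congrArg (fun f => coeff f 0) hquad
  simp [coeff_C, coeff_X, coeff_X_pow] at hp hq hr
  exact ⟨hp, hq, hr⟩

/-- For a Möbius transformation T(z) = (az+b)/(cz+d), the functional equation
k·T(k·z) = T(z) (for k ≠ 0, 1) forces bd = 0, ac = 0, and ad = 0 or k = −1. -/
theorem moebius_kTkz_eq_Tz (a b c d k : ℂ) (hdet : a * d - b * c ≠ 0)
    (hk0 : k ≠ 0) (hk1 : k ≠ 1)
    (h : ∀ z : ℂ, c * k * z + d ≠ 0 → c * z + d ≠ 0 →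
      k * ((a * (k * z) + b) / (c * (k * z) + d)) = (a * z + b) / (c * z + d)) :
    b * d = 0 ∧ a * c = 0 ∧ (a * d = 0 ∨ k = -1) := by
  have hk1' : k - 1 ≠ 0 := sub_ne_zero.2 hk1
  have hcd : c ≠ 0 ∨ d ≠ 0 := by
    by_contra! hcd
    simp [hcd.1, hcd.2] at hdet
  obtain ⟨hac, had, hbd⟩ := quadratic_coeffs_eq_zero_of_forall_linear_ne_zero
    (p := k * (k - 1) * (a * c)) (q := (k - 1) * ((k + 1) * (a * d))) (r := (k - 1) * (b * d))
    (hcd.imp_left fun hc => mul_ne_zero hc hk0) hcd (by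
      intro z hz₁ hz₂
      have hz := h z hz₁ hz₂
      rw [mul_assoc] at hz₁
      rw [← mul_div_assoc, div_eq_div_iff hz₁ hz₂] at hz
      linear_combination hz)
  refine ⟨(mul_eq_zero.1 hbd).resolve_left hk1',
    (mul_eq_zero.1 hac).resolve_left (mul_ne_zero hk0 hk1'), ?_⟩
  rcases mul_eq_zero.1 ((mul_eq_zero.1 had).resolve_left hk1') with hk | had
  · exact Or.inr (eq_neg_of_add_eq_zero_left hk)
  · exact Or.inl had
end

section
/- For real k > 1 and c ∈ (0,1), the function ζ ↦ (g(k,c,ζ) − 1)/(ζ − c) is interval-integrable on (−1, 1) with respect to Lebesgue measure. -/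
/-- The integrand of the regularized accessory-parameter integral:
g(k,c,ζ) = ((c + k/c)/(ζ + k/c)) · √(((1−c)(k+c)(1+ζ)(k−ζ))/((1+c)(k−c)(1−ζ)(k+ζ))). -/
noncomputable def sphericalG (k c ζ : ℝ) : ℝ :=
  ((c + k / c) / (ζ + k / c)) *
    Real.sqrt (((1 - c) * (k + c) * (1 + ζ) * (k - ζ)) /
      ((1 + c) * (k - c) * (1 - ζ) * (k + ζ)))

/-- The difference quotient of a function continuous on `[a, b]` and differentiable at an
interior point `c` is integrable on `[a, b]`. -/
theorem intervalIntegrable_slope_of_continuousOn {f : ℝ → ℝ} {a b c : ℝ} (hc : c ∈ Set.Ioo a b)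
    (hf : ContinuousOn f (Set.Icc a b)) (hd : DifferentiableAt ℝ f c) :
    IntervalIntegrable (fun x => (f x - f c) / (x - c)) MeasureTheory.volume a b := by
  have hab : a ≤ b := (hc.1.trans hc.2).le
  have h : IntervalIntegrable (dslope f c) MeasureTheory.volume a b := by
    apply ContinuousOn.intervalIntegrable
    rw [Set.uIcc_of_le hab]
    exact (continuousOn_dslope (Icc_mem_nhds hc.1 hc.2)).2 ⟨hf, hd⟩
  refine h.congr_ae (MeasureTheory.ae_restrict_of_ae ?_)
  filter_upwards [MeasureTheory.Measure.ae_ne MeasureTheory.volume c] with x hx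
  rw [dslope_of_ne f hx, slope_def_field]

/-- The function `(b - x) ^ (-1/2)` is integrable on every interval. -/
theorem intervalIntegrable_inv_sqrt_sub (a b d : ℝ) :
    IntervalIntegrable (fun x => (b - x) ^ (-(1 / 2) : ℝ)) MeasureTheory.volume a d := by
  have h := (intervalIntegral.intervalIntegrable_rpow' (a := b - a) (b := b - d)
    (r := -(1 / 2)) (by norm_num)).comp_sub_left b
  simpa using h

/-- `sphericalG` factors as a regular function times `(1 - ζ) ^ (-1/2)`. -/
theorem sphericalG_eq_mul_rpow (k c : ℝ) {ζ : ℝ} (hζ : ζ ≤ 1) :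
    sphericalG k c ζ = ((c + k / c) / (ζ + k / c) *
      Real.sqrt (((1 - c) * (k + c) * (1 + ζ) * (k - ζ)) / ((1 + c) * (k - c) * (k + ζ)))) *
        (1 - ζ) ^ (-(1 / 2) : ℝ) := by
  have h : 0 ≤ 1 - ζ := sub_nonneg.2 hζ
  rw [sphericalG, Real.rpow_neg h, ← Real.sqrt_eq_rpow, ← Real.sqrt_inv, mul_assoc (_ / _),
    ← Real.sqrt_mul' _ (inv_nonneg.2 h), ← div_eq_mul_inv, div_div]
  congr 3
  ring

/-- For k > 1 and c ∈ (0,1), the function ζ ↦ (g(k,c,ζ) − 1)/(ζ − c) is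
interval-integrable on (−1,1). -/
theorem sphericalG_intervalIntegrable (k c : ℝ) (hk : 1 < k)
    (hc : c ∈ Set.Ioo (0 : ℝ) 1) :
    IntervalIntegrable (fun ζ => (sphericalG k c ζ - 1) / (ζ - c))
      MeasureTheory.volume (-1) 1 := by
  obtain ⟨hc0, hc1⟩ := hc
  have hkc : 1 < k / c := by rw [lt_div_iff₀ hc0]; linarith
  have hA : ∀ ζ : ℝ, -1 ≤ ζ → ζ + k / c ≠ 0 := fun ζ h => by
    have : 0 < ζ + k / c := by linarith
    exact this.ne'
  have hD : ∀ ζ : ℝ, -1 ≤ ζ → ζ < 1 → (1 + c) * (k - c) * (1 - ζ) * (k + ζ) ≠ 0 := by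
    intro ζ h1 h2
    have h3 : 0 < k - c := by linarith
    have h4 : 0 < 1 - ζ := by linarith
    have h5 : 0 < k + ζ := by linarith
    positivity
  have hQ : ((1 - c) * (k + c) * (1 + c) * (k - c)) /
      ((1 + c) * (k - c) * (1 - c) * (k + c)) = 1 := by
    rw [div_eq_one_iff_eq (hD c (by linarith) hc1)]
    ring
  have hgc : sphericalG k c c = 1 := by
    rw [sphericalG, hQ, Real.sqrt_one, mul_one, div_self (hA c (by linarith))]
  have hleft : IntervalIntegrable (fun ζ => (sphericalG k c ζ - 1) / (ζ - c))
      MeasureTheory.volume (-1) ((1 + c) / 2) := by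
    have h := intervalIntegrable_slope_of_continuousOn (f := sphericalG k c) (a := -1)
      (b := (1 + c) / 2) (c := c) ⟨by linarith, by linarith⟩ ?_ ?_
    · rwa [hgc] at h
    · unfold sphericalG
      refine ContinuousOn.mul (ContinuousOn.div (by fun_prop) (by fun_prop)
        fun ζ hζ => hA ζ hζ.1) (ContinuousOn.sqrt (ContinuousOn.div (by fun_prop) (by fun_prop)
        fun ζ hζ => hD ζ hζ.1 (by linarith [hζ.2])))
    · unfold sphericalG
      refine DifferentiableAt.mul (DifferentiableAt.div (by fun_prop) (by fun_prop)
        (hA c (by linarith))) (DifferentiableAt.sqrt (DifferentiableAt.div (by fun_prop)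
        (by fun_prop) (hD c (by linarith) hc1)) ?_)
      rw [hQ]
      exact one_ne_zero
  refine hleft.trans ?_
  have hu : Set.uIcc ((1 + c) / 2) 1 = Set.Icc ((1 + c) / 2) 1 :=
    Set.uIcc_of_le (by linarith)
  simp_rw [div_eq_mul_inv (sphericalG k c _ - 1)]
  refine IntervalIntegrable.mul_continuousOn (IntervalIntegrable.sub ?_ (by simp)) ?_
  · have hreg : ContinuousOn (fun ζ => (c + k / c) / (ζ + k / c) *
        Real.sqrt (((1 - c) * (k + c) * (1 + ζ) * (k - ζ)) / ((1 + c) * (k - c) * (k + ζ))))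
        (Set.uIcc ((1 + c) / 2) 1) := by
      rw [hu]
      refine ContinuousOn.mul (ContinuousOn.div (by fun_prop) (by fun_prop)
        fun ζ hζ => hA ζ (by linarith [hζ.1])) (ContinuousOn.sqrt (ContinuousOn.div
        (by fun_prop) (by fun_prop) fun ζ hζ => ?_))
      have h3 : 0 < k - c := by linarith
      have h5 : 0 < k + ζ := by linarith [hζ.1]
      positivity
    refine ((intervalIntegrable_inv_sqrt_sub _ 1 _).continuousOn_mul hreg).congr ?_
    intro ζ hζ
    rw [Set.uIoc_of_le (by linarith)] at hζ
    exact (sphericalG_eq_mul_rpow k c hζ.2).symm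
  · rw [hu]
    exact ContinuousOn.inv₀ (by fun_prop) fun ζ hζ =>
      (by linarith [hζ.1] : 0 < ζ - c).ne'
end

section
/- Fix a real number k > 1. Define F₁(k,c) = √( ((1+c)(k−c)) / ((1−c)(k+c)) ) · F(k,c) for c ∈ (0,1). Then the function c ↦ F₁(k,c) is strictly decreasing on the interval (0,1). -/
/-- The regularized accessory-parameter integral
F(k,c) = ∫_{−1}^{1} (g(k,c,ζ) − 1)/(ζ − c) dζ + log((1−c)/(1+c)). -/
noncomputable def sphericalF (k c : ℝ) : ℝ :=
  (∫ ζ in (-1 : ℝ)..1, (sphericalG k c ζ - 1) / (ζ - c)) + Real.log ((1 - c) / (1 + c))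

/-- A continuous function times `1 / √(1 - x²)` is integrable on `[-1, 1]`. -/
lemma intervalIntegrable_mul_one_div_sqrt {f : ℝ → ℝ} (hf : ContinuousOn f (Set.Icc (-1) 1)) :
    IntervalIntegrable (fun x => f x * (1 / √(1 - x ^ 2))) MeasureTheory.volume (-1) 1 := by
  have h : IntervalIntegrable (fun x : ℝ => 1 / √(1 - x ^ 2)) MeasureTheory.volume (-1) 1 := by
    apply intervalIntegral.intervalIntegrable_deriv_of_nonneg (g := Real.arcsin)
      Real.continuous_arcsin.continuousOn
    · intro x hx
      rw [min_eq_left (by norm_num), max_eq_right (by norm_num)] at hx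
      exact Real.hasDerivAt_arcsin hx.1.ne' hx.2.ne
    · intro x _
      positivity
  apply h.continuousOn_mul
  rwa [Set.uIcc_of_le (by norm_num)]

/-- The factor `√((1 + x)(k - x))`, the numerator of the square root in `sphericalG`. -/
noncomputable def sqrtNum (k x : ℝ) : ℝ := √((1 + x) * (k - x))

/-- The factor `√((1 - x)(k + x))`, the denominator of the square root in `sphericalG`. -/
noncomputable def sqrtDen (k x : ℝ) : ℝ := √((1 - x) * (k + x))

section

variable {k x : ℝ}

lemma sqrtNum_pos (hk : 1 < k) (hx : x ∈ Set.Ioo (-1 : ℝ) 1) : 0 < sqrtNum k x :=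
  Real.sqrt_pos.2 (mul_pos (by linarith [hx.1]) (by linarith [hx.2]))

lemma sqrtDen_pos (hk : 1 < k) (hx : x ∈ Set.Ioo (-1 : ℝ) 1) : 0 < sqrtDen k x :=
  Real.sqrt_pos.2 (mul_pos (by linarith [hx.2]) (by linarith [hx.1]))

lemma sq_sqrtNum (hk : 1 < k) (hx : x ∈ Set.Ioo (-1 : ℝ) 1) :
    sqrtNum k x ^ 2 = (1 + x) * (k - x) :=
  Real.sq_sqrt (mul_pos (by linarith [hx.1]) (by linarith [hx.2])).le

lemma sq_sqrtDen (hk : 1 < k) (hx : x ∈ Set.Ioo (-1 : ℝ) 1) :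
    sqrtDen k x ^ 2 = (1 - x) * (k + x) :=
  Real.sq_sqrt (mul_pos (by linarith [hx.2]) (by linarith [hx.1])).le

lemma continuous_sqrtNum : Continuous (sqrtNum k) := by
  unfold sqrtNum
  fun_prop

lemma continuous_sqrtDen : Continuous (sqrtDen k) := by
  unfold sqrtDen
  fun_prop

lemma sqrtNum_mul_sqrtDen (hk : 1 < k) (hx : x ∈ Set.Ioo (-1 : ℝ) 1) :
    sqrtNum k x * sqrtDen k x = √(1 - x ^ 2) * √(k ^ 2 - x ^ 2) := by
  rw [sqrtNum, sqrtDen, ← Real.sqrt_mul (by nlinarith [hx.1, hx.2]),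
    ← Real.sqrt_mul (by nlinarith [hx.1, hx.2])]
  ring_nf

lemma add_sqrt_pos (hk : 1 < k) {v : ℝ} (hv : 0 < v) (hx : x ∈ Set.Icc (-1 : ℝ) 1) :
    0 < sqrtNum k x + v * sqrtDen k x := by
  rcases hx.1.eq_or_lt with h | h
  · have : 0 < sqrtDen k x := Real.sqrt_pos.2 (by rw [← h]; nlinarith)
    have : 0 ≤ sqrtNum k x := Real.sqrt_nonneg _
    positivity
  · have : 0 ≤ sqrtDen k x := Real.sqrt_nonneg _
    have : 0 < sqrtNum k x := Real.sqrt_pos.2 (mul_pos (by linarith) (by linarith [hx.2]))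
    positivity

/-- The derivative of `log (k + c x) - 2 log (sqrtNum k x + v * sqrtDen k x)` in `x`. -/
noncomputable def logQuotDeriv (k c v x : ℝ) : ℝ :=
  c / (k + c * x) - ((k - 1 - 2 * x) * sqrtDen k x - v * (k - 1 + 2 * x) * sqrtNum k x) /
    (sqrtNum k x * sqrtDen k x * (sqrtNum k x + v * sqrtDen k x))

lemma hasDerivAt_logQuot (hk : 1 < k) {c v : ℝ} (hv : 0 < v) (hc : c ∈ Set.Ioo (0 : ℝ) 1)
    (hx : x ∈ Set.Ioo (-1 : ℝ) 1) :
    HasDerivAt (fun x => Real.log (k + c * x) - 2 * Real.log (sqrtNum k x + v * sqrtDen k x))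
      (logQuotDeriv k c v x) x := by
  have hA := sqrtNum_pos hk hx
  have hB := sqrtDen_pos hk hx
  have hs := add_sqrt_pos hk hv ⟨hx.1.le, hx.2.le⟩
  have hkc : 0 < k + c * x := by nlinarith [hx.1, hx.2, hc.1, hc.2]
  have dA : HasDerivAt (sqrtNum k) ((k - 1 - 2 * x) / (2 * sqrtNum k x)) x := by
    have h : HasDerivAt (fun x => (1 + x) * (k - x)) (k - 1 - 2 * x) x := by
      exact (((hasDerivAt_id' x).const_add 1).mul ((hasDerivAt_id' x).const_sub k)).congr_deriv
        (by ring)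
    exact h.sqrt (Real.sqrt_pos.1 hA).ne'
  have dB : HasDerivAt (sqrtDen k) (-(k - 1 + 2 * x) / (2 * sqrtDen k x)) x := by
    have h : HasDerivAt (fun x => (1 - x) * (k + x)) (-(k - 1 + 2 * x)) x := by
      exact (((hasDerivAt_id' x).const_sub 1).mul ((hasDerivAt_id' x).const_add k)).congr_deriv
        (by ring)
    exact h.sqrt (Real.sqrt_pos.1 hB).ne'
  have dL : HasDerivAt (fun x => k + c * x) c x := by
    simpa using ((hasDerivAt_id x).const_mul c).const_add k
  refine ((dL.log hkc.ne').sub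
    (((dA.add (dB.const_mul v)).log hs.ne').const_mul 2)).congr_deriv ?_
  simp only [logQuotDeriv, Pi.add_apply]
  field_simp
  ring

lemma intervalIntegrable_logQuotDeriv (hk : 1 < k) {c v : ℝ} (hv : 0 < v)
    (hc : c ∈ Set.Ioo (0 : ℝ) 1) :
    IntervalIntegrable (logQuotDeriv k c v) MeasureTheory.volume (-1) 1 := by
  have h1 : IntervalIntegrable (fun x => c / (k + c * x)) MeasureTheory.volume (-1) 1 := by
    apply ContinuousOn.intervalIntegrable
    rw [Set.uIcc_of_le (by norm_num)]
    refine continuousOn_const.div (by fun_prop) fun x hx => ?_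
    nlinarith [hx.1, hx.2, hc.1, hc.2]
  have h2 := intervalIntegrable_mul_one_div_sqrt
    (f := fun x => ((k - 1 - 2 * x) * sqrtDen k x - v * (k - 1 + 2 * x) * sqrtNum k x) /
      (√(k ^ 2 - x ^ 2) * (sqrtNum k x + v * sqrtDen k x))) (by
      have := continuous_sqrtNum (k := k)
      have := continuous_sqrtDen (k := k)
      refine ContinuousOn.div (by fun_prop) (by fun_prop) fun x hx => ?_
      exact (mul_pos (Real.sqrt_pos.2 (by nlinarith [hx.1, hx.2])) (add_sqrt_pos hk hv hx)).ne')
  refine (h1.sub h2).congr_uIoo fun x hx => ?_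
  rw [Set.uIoo_of_le (by norm_num)] at hx
  simp only [logQuotDeriv, sqrtNum_mul_sqrtDen hk hx]
  rw [div_mul_div_comm, mul_one]
  congr 2
  ring

lemma integral_logQuotDeriv (hk : 1 < k) {c v : ℝ} (hv : 0 < v) (hc : c ∈ Set.Ioo (0 : ℝ) 1) :
    ∫ x in (-1 : ℝ)..1, logQuotDeriv k c v x =
      Real.log (k + c) - Real.log (k - c) + 2 * Real.log v := by
  have hcont : ContinuousOn
      (fun x => Real.log (k + c * x) - 2 * Real.log (sqrtNum k x + v * sqrtDen k x))
      (Set.Icc (-1) 1) := by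
    have := continuous_sqrtNum (k := k)
    have := continuous_sqrtDen (k := k)
    refine ContinuousOn.sub (ContinuousOn.log (by fun_prop) fun x hx => ?_)
      (continuousOn_const.mul (ContinuousOn.log (by fun_prop) fun x hx =>
        (add_sqrt_pos hk hv hx).ne'))
    nlinarith [hx.1, hx.2, hc.1, hc.2]
  rw [intervalIntegral.integral_eq_sub_of_hasDerivAt_of_le (by norm_num) hcont
    (fun x hx => hasDerivAt_logQuot hk hv hc hx) (intervalIntegrable_logQuotDeriv hk hv hc)]
  have hpos : 0 < √(2 * (k - 1)) := Real.sqrt_pos.2 (by linarith)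
  have hA1 : sqrtNum k 1 = √(2 * (k - 1)) := by rw [sqrtNum]; ring_nf
  have hB1 : sqrtDen k 1 = 0 := by simp [sqrtDen]
  have hA2 : sqrtNum k (-1) = 0 := by simp [sqrtNum]
  have hB2 : sqrtDen k (-1) = √(2 * (k - 1)) := by rw [sqrtDen]; ring_nf
  rw [hA1, hB1, hA2, hB2, zero_add, mul_zero, add_zero, Real.log_mul hv.ne' hpos.ne', mul_one,
    mul_neg_one, ← sub_eq_add_neg]
  ring

/-- Partial fractions: up to the factor `v`, the integrand of `sphericalF` is a term independent
of `c`, minus a nonsingular term monotone in `c`, plus an exact derivative. -/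
lemma integrand_decomposition {c v A B : ℝ} (hv : 0 < v) (hA : 0 < A) (hB : 0 < B)
    (hA2 : A ^ 2 = (1 + x) * (k - x)) (hB2 : B ^ 2 = (1 - x) * (k + x))
    (hv2 : v ^ 2 * ((1 - c) * (k + c)) = (1 + c) * (k - c))
    (hD : (1 - c) * (k + c) ≠ 0) (hxc : x - c ≠ 0) (hkc : k + c * x ≠ 0) :
    (((c ^ 2 + k) / (k + c * x)) * (A / B) - v) / (x - c) =
      (k - 1 - 2 * x) / (A * B) - 2 * (c / (k + c * x) * (A / B)) +
      v * (c / (k + c * x) - ((k - 1 - 2 * x) * B - v * (k - 1 + 2 * x) * A) /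
        (A * B * (A + v * B))) := by
  have hs : A + v * B ≠ 0 := by positivity
  have key : (A ^ 2 - v ^ 2 * B ^ 2) * (k + 2 * c * x - c ^ 2) =
      (k - 1 - 2 * x + v ^ 2 * (k - 1 + 2 * x)) * ((x - c) * (k + c * x)) := by
    apply mul_right_cancel₀ hD
    rw [hA2, hB2]
    linear_combination (-(1 - x) * (k + x) * (k + 2 * c * x - c ^ 2) -
      (k - 1 + 2 * x) * ((x - c) * (k + c * x))) * hv2
  have e1 : (c ^ 2 + k) / (k + c * x) = (x - c) * (1 / (x - c) - c / (k + c * x)) := by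
    field_simp
    ring
  have e2 : (k - 1 - 2 * x) / (A * B) - v * (((k - 1 - 2 * x) * B - v * (k - 1 + 2 * x) * A) /
      (A * B * (A + v * B))) = (A - v * B) / B * (1 / (x - c) + c / (k + c * x)) := by
    have : (k - 1 - 2 * x) / (A * B) - v * (((k - 1 - 2 * x) * B - v * (k - 1 + 2 * x) * A) /
      (A * B * (A + v * B))) =
        (k - 1 - 2 * x + v ^ 2 * (k - 1 + 2 * x)) / (B * (A + v * B)) := by
      field_simp
      ring
    have hsum : 1 / (x - c) + c / (k + c * x) =
        (k + 2 * c * x - c ^ 2) / ((x - c) * (k + c * x)) := by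
      rw [div_add_div _ _ hxc hkc]
      ring
    rw [this, hsum, div_mul_div_comm, div_eq_div_iff (by positivity) (by positivity)]
    linear_combination -B * key
  have e3 : (A - v * B) / B = A / B - v := by field_simp
  rw [e3] at e2
  rw [e1, sub_div, mul_assoc, mul_div_cancel_left₀ _ hxc]
  linear_combination -e2

lemma intervalIntegrable_sqrt_ratio (hk : 1 < k) {c : ℝ} (hc : c ∈ Set.Ioo (0 : ℝ) 1) :
    IntervalIntegrable (fun x => c / (k + c * x) * (sqrtNum k x / sqrtDen k x))
      MeasureTheory.volume (-1) 1 := by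
  refine (intervalIntegrable_mul_one_div_sqrt
    (f := fun x => c / (k + c * x) * ((1 + x) * (k - x) / √(k ^ 2 - x ^ 2))) ?_).congr_uIoo
      fun x hx => ?_
  · refine ContinuousOn.mul (ContinuousOn.div (by fun_prop) (by fun_prop) fun x hx => ?_)
      (ContinuousOn.div (by fun_prop) (by fun_prop) fun x hx => ?_)
    · nlinarith [hx.1, hx.2, hc.1, hc.2]
    · exact (Real.sqrt_pos.2 (by nlinarith [hx.1, hx.2])).ne'
  · rw [Set.uIoo_of_le (by norm_num)] at hx
    have hA := sqrtNum_pos hk hx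
    have hB := sqrtDen_pos hk hx
    simp only
    rw [mul_assoc, div_mul_div_comm, mul_one, mul_comm (√(k ^ 2 - x ^ 2)),
      ← sqrtNum_mul_sqrtDen hk hx, ← sq_sqrtNum hk hx]
    field_simp

lemma intervalIntegrable_deriv_ratio (hk : 1 < k) :
    IntervalIntegrable (fun x => (k - 1 - 2 * x) / (sqrtNum k x * sqrtDen k x))
      MeasureTheory.volume (-1) 1 := by
  refine (intervalIntegrable_mul_one_div_sqrt
    (f := fun x => (k - 1 - 2 * x) / √(k ^ 2 - x ^ 2)) ?_).congr_uIoo fun x hx => ?_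
  · refine ContinuousOn.div (by fun_prop) (by fun_prop) fun x hx => ?_
    exact (Real.sqrt_pos.2 (by nlinarith [hx.1, hx.2])).ne'
  · rw [Set.uIoo_of_le (by norm_num)] at hx
    simp only
    rw [div_mul_div_comm, mul_one, mul_comm (√(k ^ 2 - x ^ 2)), ← sqrtNum_mul_sqrtDen hk hx]

/-- Regular form of `F₁`: only the second integral depends on `c`. -/
lemma sqrt_mul_sphericalF (hk : 1 < k) {c : ℝ} (hc : c ∈ Set.Ioo (0 : ℝ) 1) :
    √(((1 + c) * (k - c)) / ((1 - c) * (k + c))) * sphericalF k c =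
      (∫ x in (-1 : ℝ)..1, (k - 1 - 2 * x) / (sqrtNum k x * sqrtDen k x)) -
        2 * ∫ x in (-1 : ℝ)..1, c / (k + c * x) * (sqrtNum k x / sqrtDen k x) := by
  obtain ⟨hc0, hc1⟩ := hc
  have h1 : 0 < 1 + c := by linarith
  have h2 : 0 < 1 - c := by linarith
  have h3 : 0 < k - c := by linarith
  have h4 : 0 < k + c := by linarith
  set v := √(((1 + c) * (k - c)) / ((1 - c) * (k + c))) with hv_def
  have hv : 0 < v := Real.sqrt_pos.2 (by positivity)
  have hv2 : v ^ 2 = ((1 + c) * (k - c)) / ((1 - c) * (k + c)) := Real.sq_sqrt (by positivity)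
  have hlog : 2 * Real.log v =
      Real.log (1 + c) + Real.log (k - c) - (Real.log (1 - c) + Real.log (k + c)) := by
    rw [← Real.log_mul h1.ne' h3.ne', ← Real.log_mul h2.ne' h4.ne',
      ← Real.log_div (by positivity) (by positivity), ← hv2, Real.log_pow]
    norm_num
  have hint : ∫ x in (-1 : ℝ)..1, v * ((sphericalG k c x - 1) / (x - c)) =
      ∫ x in (-1 : ℝ)..1, ((k - 1 - 2 * x) / (sqrtNum k x * sqrtDen k x) -
        2 * (c / (k + c * x) * (sqrtNum k x / sqrtDen k x)) + v * logQuotDeriv k c v x) := by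
    apply intervalIntegral.integral_congr_ae
    filter_upwards [MeasureTheory.volume.ae_ne c, MeasureTheory.volume.ae_ne 1] with x hxc hx1 hx
    rw [Set.uIoc_of_le (by norm_num)] at hx
    replace hx : x ∈ Set.Ioo (-1 : ℝ) 1 := ⟨hx.1, lt_of_le_of_ne hx.2 hx1⟩
    have hA := sqrtNum_pos hk hx
    have hB := sqrtDen_pos hk hx
    have hkc : 0 < k + c * x := by nlinarith [hx.1, hx.2]
    rw [logQuotDeriv, ← integrand_decomposition hv hA hB (sq_sqrtNum hk hx) (sq_sqrtDen hk hx)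
      (by rw [hv2]; field_simp) (by positivity) (sub_ne_zero.2 hxc) hkc.ne']
    have hG : sphericalG k c x =
        ((c ^ 2 + k) / (k + c * x)) * (sqrtNum k x / sqrtDen k x) / v := by
      have hsplit : ((1 - c) * (k + c) * (1 + x) * (k - x)) /
          ((1 + c) * (k - c) * (1 - x) * (k + x)) =
          ((1 + x) * (k - x) / ((1 - x) * (k + x))) /
            (((1 + c) * (k - c)) / ((1 - c) * (k + c))) := by
        rw [div_div_div_eq]
        congr 1 <;> ring
      have hfrac : (c + k / c) / (x + k / c) = (c ^ 2 + k) / (k + c * x) := by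
        have : x + k / c = (k + c * x) / c := by field_simp; ring
        rw [this]
        field_simp
      have hxA := mul_pos (show 0 < 1 + x by linarith [hx.1]) (show 0 < k - x by linarith [hx.2])
      rw [sphericalG, hsplit, hfrac, Real.sqrt_div' _ (by positivity), Real.sqrt_div hxA.le,
        ← hv_def, sqrtNum, sqrtDen, mul_div_assoc]
    rw [hG]
    field_simp
  rw [sphericalF, mul_add, ← intervalIntegral.integral_const_mul, hint,
    intervalIntegral.integral_add ((intervalIntegrable_deriv_ratio hk).sub
      ((intervalIntegrable_sqrt_ratio hk ⟨hc0, hc1⟩).const_mul 2))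
      ((intervalIntegrable_logQuotDeriv hk hv ⟨hc0, hc1⟩).const_mul v),
    intervalIntegral.integral_sub (intervalIntegrable_deriv_ratio hk)
      ((intervalIntegrable_sqrt_ratio hk ⟨hc0, hc1⟩).const_mul 2),
    intervalIntegral.integral_const_mul, intervalIntegral.integral_const_mul,
    integral_logQuotDeriv hk hv ⟨hc0, hc1⟩, Real.log_div h2.ne' h1.ne', hlog]
  ring

end

/-- For fixed k > 1, the function c ↦ F₁(k,c) = √(((1+c)(k−c))/((1−c)(k+c))) · F(k,c)
is strictly decreasing on (0,1). -/
theorem sphericalF1_strictAnti (k : ℝ) (hk : 1 < k) :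
    StrictAntiOn
      (fun c => Real.sqrt (((1 + c) * (k - c)) / ((1 - c) * (k + c))) * sphericalF k c)
      (Set.Ioo (0 : ℝ) 1) := by
  intro c₁ hc₁ c₂ hc₂ h
  simp only
  rw [sqrt_mul_sphericalF hk hc₁, sqrt_mul_sphericalF hk hc₂]
  have h₁ := intervalIntegrable_sqrt_ratio hk hc₁
  have h₂ := intervalIntegrable_sqrt_ratio hk hc₂
  have hpos := intervalIntegral.intervalIntegral_pos_of_pos_on (h₂.sub h₁) (fun x hx => by
    have hk₁ : 0 < k + c₁ * x := by nlinarith [hx.1, hx.2, hc₁.1, hc₁.2]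
    have hk₂ : 0 < k + c₂ * x := by nlinarith [hx.1, hx.2, hc₂.1, hc₂.2]
    rw [← sub_mul]
    refine mul_pos (sub_pos.2 ?_) (div_pos (sqrtNum_pos hk hx) (sqrtDen_pos hk hx))
    rw [div_lt_div_iff₀ hk₁ hk₂]
    nlinarith) (by norm_num)
  rw [intervalIntegral.integral_sub h₂ h₁] at hpos
  linarith
end

section
/- For every real k > 1 there exists at most one c ∈ (0, 1) such that F(k, c) = 0. -/
open MeasureTheory Set intervalIntegral

/-- The quartic root `√((1 - z²)(k² - z²))` of the elliptic curve in Legendre form. -/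
noncomputable def legendreRoot (k z : ℝ) : ℝ := Real.sqrt ((1 - z ^ 2) * (k ^ 2 - z ^ 2))

/-- The nonsingular kernel whose integral against `dz / legendreRoot k z` is proportional to
`sphericalF k c`. -/
noncomputable def sphericalKernel (k c z : ℝ) : ℝ :=
  (k ^ 2 + c ^ 2 * z ^ 2) / (k ^ 2 - c ^ 2 * z ^ 2) - (k + c ^ 2) / ((1 + c) * (k - c))

lemma legendreRoot_radicand_pos {k z : ℝ} (hk : 1 < k) (hz : z ∈ Ioo (-1 : ℝ) 1) :
    0 < (1 - z ^ 2) * (k ^ 2 - z ^ 2) := by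
  obtain ⟨h1, h2⟩ := hz
  have : 0 < 1 - z ^ 2 := by nlinarith
  have : 0 < k ^ 2 - z ^ 2 := by nlinarith
  positivity

lemma legendreRoot_pos {k z : ℝ} (hk : 1 < k) (hz : z ∈ Ioo (-1 : ℝ) 1) :
    0 < legendreRoot k z :=
  Real.sqrt_pos.2 (legendreRoot_radicand_pos hk hz)

lemma legendreRoot_sq {k z : ℝ} (hk : 1 < k) (hz : z ∈ Ioo (-1 : ℝ) 1) :
    legendreRoot k z ^ 2 = (1 - z ^ 2) * (k ^ 2 - z ^ 2) :=
  Real.sq_sqrt (legendreRoot_radicand_pos hk hz).le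

lemma legendreRoot_neg (k z : ℝ) : legendreRoot k (-z) = legendreRoot k z := by
  simp [legendreRoot]

lemma continuous_legendreRoot (k : ℝ) : Continuous (legendreRoot k) := by
  unfold legendreRoot; fun_prop

lemma hasDerivAt_legendreRoot {k z : ℝ} (hk : 1 < k) (hz : z ∈ Ioo (-1 : ℝ) 1) :
    HasDerivAt (legendreRoot k) (-(z * (k ^ 2 + 1 - 2 * z ^ 2)) / legendreRoot k z) z := by
  have h : HasDerivAt (fun x : ℝ => (1 - x ^ 2) * (k ^ 2 - x ^ 2))
      (-(2 * z) * (k ^ 2 - z ^ 2) + (1 - z ^ 2) * (-(2 * z))) z := by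
    have h0 : HasDerivAt (fun x : ℝ => x ^ 2) (2 * z) z := by simpa using hasDerivAt_pow 2 z
    exact (h0.const_sub 1).mul (h0.const_sub (k ^ 2))
  refine (h.sqrt (legendreRoot_radicand_pos hk hz).ne').congr_deriv ?_
  have := (legendreRoot_pos hk hz).ne'
  change _ / (2 * legendreRoot k z) = _
  field_simp
  ring

lemma intervalIntegrable_div_sqrt_one_sub {f : ℝ → ℝ} {a : ℝ} (ha : a ≤ 1)
    (hf : ContinuousOn f (Icc a 1)) :
    IntervalIntegrable (fun z => f z / Real.sqrt (1 - z)) volume a 1 := by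
  have h : IntervalIntegrable (fun x : ℝ => x ^ (-(1 / 2) : ℝ)) volume (1 - a) (1 - 1) :=
    intervalIntegrable_rpow' (by norm_num)
  have h2 := h.comp_sub_left 1
  simp only [sub_sub_cancel] at h2
  refine (h2.continuousOn_mul (by rwa [uIcc_of_le ha])).congr ?_
  intro z hz
  rw [uIoc_of_le ha] at hz
  simp only [div_eq_mul_inv, Real.sqrt_eq_rpow]
  rw [Real.rpow_neg (by linarith [hz.2])]

lemma intervalIntegrable_div_legendreRoot {k : ℝ} (hk : 1 < k) {f : ℝ → ℝ}
    (hf : ContinuousOn f (Icc 0 1)) :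
    IntervalIntegrable (fun z => f z / legendreRoot k z) volume 0 1 := by
  have h : ContinuousOn (fun z => f z / Real.sqrt ((1 + z) * (k ^ 2 - z ^ 2))) (Icc 0 1) := by
    refine hf.div (by fun_prop) fun z hz => (Real.sqrt_pos.2 ?_).ne'
    have : 0 < 1 + z := by linarith [hz.1]
    have : 0 < k ^ 2 - z ^ 2 := by nlinarith [hz.1, hz.2]
    positivity
  refine (intervalIntegrable_div_sqrt_one_sub zero_le_one h).congr ?_
  intro z hz
  rw [uIoc_of_le zero_le_one] at hz
  have : legendreRoot k z = Real.sqrt ((1 + z) * (k ^ 2 - z ^ 2)) * Real.sqrt (1 - z) := by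
    rw [← Real.sqrt_mul' _ (by linarith [hz.2]), legendreRoot]
    ring_nf
  simp only [this, div_div]

lemma integral_div_legendreRoot_pos {k : ℝ} (hk : 1 < k) :
    0 < ∫ z in (0 : ℝ)..1, (k + 1 - 2 * k * z ^ 2) / legendreRoot k z := by
  have hden : ∀ z ∈ Icc (0 : ℝ) 1, 0 < k ^ 2 - z ^ 2 := fun z hz => by
    nlinarith [hz.1, hz.2]
  have hi2 : IntervalIntegrable (fun z =>
      k * (1 - 2 * z ^ 2 + z ^ 2 * (1 - z ^ 2) / (k ^ 2 - z ^ 2)) / legendreRoot k z)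
      volume 0 1 := by
    refine intervalIntegrable_div_legendreRoot hk ?_
    refine ContinuousOn.mul (by fun_prop) (ContinuousOn.add (by fun_prop) ?_)
    exact ContinuousOn.div (by fun_prop) (by fun_prop) fun z hz => (hden z hz).ne'
  have hW : ∫ z in (0 : ℝ)..1,
      k * (1 - 2 * z ^ 2 + z ^ 2 * (1 - z ^ 2) / (k ^ 2 - z ^ 2)) / legendreRoot k z = 0 := by
    have := integral_eq_sub_of_hasDerivAt_of_le (a := 0) (b := 1) zero_le_one
      (f := fun z => k * z * legendreRoot k z / (k ^ 2 - z ^ 2))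
      (f' := fun z =>
        k * (1 - 2 * z ^ 2 + z ^ 2 * (1 - z ^ 2) / (k ^ 2 - z ^ 2)) / legendreRoot k z) ?_ ?_ ?_
    · rw [this]; simp [legendreRoot]
    · have := continuous_legendreRoot k
      exact ContinuousOn.div (by fun_prop) (by fun_prop) fun z hz => (hden z hz).ne'
    · intro z hz
      have hz' : z ∈ Ioo (-1 : ℝ) 1 := ⟨by linarith [hz.1], hz.2⟩
      have hd := hden z ⟨hz.1.le, hz.2.le⟩
      have hY := legendreRoot_pos hk hz'
      have hY2 := legendreRoot_sq hk hz'
      have h0 : HasDerivAt (fun x : ℝ => x ^ 2) (2 * z) z := by simpa using hasDerivAt_pow 2 z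
      have h1 := (((hasDerivAt_id z).const_mul k).mul (hasDerivAt_legendreRoot hk hz')).div
        (h0.const_sub (k ^ 2)) hd.ne'
      refine h1.congr_deriv ?_
      simp only [id, Pi.mul_apply]
      field_simp
      rw [hY2]
      ring
    · exact hi2
  have hi1 : IntervalIntegrable (fun z => (k + 1 - 2 * k * z ^ 2) / legendreRoot k z)
      volume 0 1 := intervalIntegrable_div_legendreRoot hk (by fun_prop)
  have hpos := intervalIntegral_pos_of_pos_on (hi1.sub hi2) (fun z hz => ?_) one_pos
  · rwa [integral_sub hi1 hi2, hW, sub_zero] at hpos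
  · have hd := hden z ⟨hz.1.le, hz.2.le⟩
    have hY := legendreRoot_pos hk (z := z) ⟨by linarith [hz.1], hz.2⟩
    have hz0 := hz.1
    have hz1 := hz.2
    have hzz : 0 < z ^ 2 * (1 - z ^ 2) := by
      have : 0 < 1 - z ^ 2 := by nlinarith
      positivity
    have : (k + 1 - 2 * k * z ^ 2) / legendreRoot k z -
        k * (1 - 2 * z ^ 2 + z ^ 2 * (1 - z ^ 2) / (k ^ 2 - z ^ 2)) / legendreRoot k z =
        ((k - 1) * (k + 1 - z ^ 2 * (1 - z ^ 2)) + (1 - z ^ 2) ^ 2) /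
          ((k ^ 2 - z ^ 2) * legendreRoot k z) := by
      field_simp
      ring
    rw [this]
    have h3 : 0 < (k - 1) * (k + 1 - z ^ 2 * (1 - z ^ 2)) :=
      mul_pos (by linarith) (by nlinarith [sq_nonneg (z ^ 2)])
    positivity

lemma kernel_denominator_pos {k c z : ℝ} (hk : 1 < k) (hc : c ∈ Ioo (0 : ℝ) 1)
    (hz : z ∈ Icc (0 : ℝ) 1) : 0 < k ^ 2 - c ^ 2 * z ^ 2 := by
  have h1 : c * z < k := by nlinarith [hc.1, hc.2, hz.1, hz.2]
  have h2 : 0 ≤ c * z := mul_nonneg hc.1.le hz.1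
  nlinarith

lemma sphericalKernel_eq {k c z : ℝ} (hk : 1 < k) (hc : c ∈ Ioo (0 : ℝ) 1)
    (hz : z ∈ Ioo (0 : ℝ) 1) :
    (1 + c) / c * sphericalKernel k c z =
      (k - 1) / k - (k - 1) * (c / (k ^ 2 - c ^ 2)) -
        2 * k ^ 2 * (1 - z ^ 2) * (c / ((k ^ 2 - c ^ 2) * (k ^ 2 - c ^ 2 * z ^ 2))) -
        2 * z ^ 2 * (1 - z ^ 2) * (c ^ 4 / ((k ^ 2 - c ^ 2) * (k ^ 2 - c ^ 2 * z ^ 2))) -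
        c ^ 2 / (k ^ 2 - c ^ 2) / k * (k + 1 - 2 * k * z ^ 2) := by
  have a3 := (kernel_denominator_pos hk hc (Ioo_subset_Icc_self hz)).ne'
  obtain ⟨h0, h1⟩ := hc
  have a1 : k - c ≠ 0 := by linarith
  have a2 : k + c ≠ 0 := by linarith
  have a4 : (1 + c) ≠ 0 := by linarith
  have a5 : k ≠ 0 := by linarith
  have a6 : k ^ 2 - c ^ 2 = (k - c) * (k + c) := by ring
  rw [sphericalKernel, a6]
  field_simp
  ring

lemma sphericalKernel_sub_ge {k c₁ c₂ z : ℝ} (hk : 1 < k) (hc₁ : c₁ ∈ Ioo (0 : ℝ) 1)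
    (hc₂ : c₂ ∈ Ioo (0 : ℝ) 1) (h : c₁ < c₂) (hz : z ∈ Ioo (0 : ℝ) 1) :
    (c₂ ^ 2 / (k ^ 2 - c₂ ^ 2) / k - c₁ ^ 2 / (k ^ 2 - c₁ ^ 2) / k) * (k + 1 - 2 * k * z ^ 2) ≤
      (1 + c₁) / c₁ * sphericalKernel k c₁ z - (1 + c₂) / c₂ * sphericalKernel k c₂ z := by
  rw [sphericalKernel_eq hk hc₁ hz, sphericalKernel_eq hk hc₂ hz]
  have hp := hc₁.1
  have hp' := hc₂.2
  have hp2 := hc₂.1.le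
  have hd1 : 0 ≤ k ^ 2 - c₁ ^ 2 := by nlinarith
  have hzz : 0 < 1 - z ^ 2 := by nlinarith [hz.1, hz.2]
  have hd : 0 < k ^ 2 - c₂ ^ 2 := by nlinarith
  have hd' : 0 < k ^ 2 - c₂ ^ 2 * z ^ 2 := by nlinarith [sq_nonneg c₂]
  have hk1 : 0 < k - 1 := by linarith
  have e1 : (k - 1) * (c₁ / (k ^ 2 - c₁ ^ 2)) ≤ (k - 1) * (c₂ / (k ^ 2 - c₂ ^ 2)) := by
    gcongr
  have e2 : 2 * k ^ 2 * (1 - z ^ 2) * (c₁ / ((k ^ 2 - c₁ ^ 2) * (k ^ 2 - c₁ ^ 2 * z ^ 2))) ≤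
      2 * k ^ 2 * (1 - z ^ 2) * (c₂ / ((k ^ 2 - c₂ ^ 2) * (k ^ 2 - c₂ ^ 2 * z ^ 2))) := by
    gcongr
  have e3 : 2 * z ^ 2 * (1 - z ^ 2) * (c₁ ^ 4 / ((k ^ 2 - c₁ ^ 2) * (k ^ 2 - c₁ ^ 2 * z ^ 2))) ≤
      2 * z ^ 2 * (1 - z ^ 2) * (c₂ ^ 4 / ((k ^ 2 - c₂ ^ 2) * (k ^ 2 - c₂ ^ 2 * z ^ 2))) := by
    gcongr
  linarith

lemma intervalIntegrable_sphericalKernel {k c : ℝ} (hk : 1 < k) (hc : c ∈ Ioo (0 : ℝ) 1) :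
    IntervalIntegrable (fun z => sphericalKernel k c z / legendreRoot k z) volume 0 1 := by
  refine intervalIntegrable_div_legendreRoot hk ?_
  unfold sphericalKernel
  refine ContinuousOn.sub (ContinuousOn.div (by fun_prop) (by fun_prop) fun z hz => ?_)
    continuousOn_const
  exact (kernel_denominator_pos hk hc hz).ne'

/-- The zeros of `c ↦ ∫ sphericalKernel k c z / legendreRoot k z dz` are unique. -/
lemma not_lt_of_integral_sphericalKernel_eq_zero {k c₁ c₂ : ℝ} (hk : 1 < k)
    (hc₁ : c₁ ∈ Ioo (0 : ℝ) 1) (hc₂ : c₂ ∈ Ioo (0 : ℝ) 1)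
    (h₁ : ∫ z in (0 : ℝ)..1, sphericalKernel k c₁ z / legendreRoot k z = 0)
    (h₂ : ∫ z in (0 : ℝ)..1, sphericalKernel k c₂ z / legendreRoot k z = 0) :
    ¬ c₁ < c₂ := by
  intro h
  have hp := hc₁.1
  have hp' := hc₂.2
  have hd : 0 < k ^ 2 - c₂ ^ 2 := by nlinarith
  have hρ : 0 < c₂ ^ 2 / (k ^ 2 - c₂ ^ 2) / k - c₁ ^ 2 / (k ^ 2 - c₁ ^ 2) / k := by
    rw [sub_pos]
    gcongr
  set ρ := c₂ ^ 2 / (k ^ 2 - c₂ ^ 2) / k - c₁ ^ 2 / (k ^ 2 - c₁ ^ 2) / k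
  have i₁ := (intervalIntegrable_sphericalKernel hk hc₁).const_mul ((1 + c₁) / c₁)
  have i₂ := (intervalIntegrable_sphericalKernel hk hc₂).const_mul ((1 + c₂) / c₂)
  have i₀ : IntervalIntegrable (fun z => (k + 1 - 2 * k * z ^ 2) / legendreRoot k z)
      volume 0 1 := intervalIntegrable_div_legendreRoot hk (by fun_prop)
  have hmono := integral_mono_on_of_le_Ioo zero_le_one (i₀.const_mul ρ) (i₁.sub i₂)
    (fun z hz => ?_)
  · rw [integral_sub i₁ i₂] at hmono
    simp only [intervalIntegral.integral_const_mul] at hmono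
    rw [h₁, h₂] at hmono
    have := mul_pos hρ (integral_div_legendreRoot_pos hk)
    linarith
  · have hY := legendreRoot_pos hk (z := z) ⟨by linarith [hz.1], hz.2⟩
    have := div_le_div_of_nonneg_right (sphericalKernel_sub_ge hk hc₁ hc₂ h hz) hY.le
    simp only [mul_div_assoc, sub_div] at this ⊢
    exact this

lemma sphericalG_eq_div_sqrt (k c : ℝ) {z : ℝ} (hz : z < 1) :
    sphericalG k c z = ((c + k / c) / (z + k / c)) *
      Real.sqrt (((1 - c) * (k + c) * (1 + z) * (k - z)) / ((1 + c) * (k - c) * (k + z))) /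
        Real.sqrt (1 - z) := by
  rw [sphericalG, mul_div_assoc (_ / _), ← Real.sqrt_div' _ (by linarith), div_div]
  congr 3
  ring

lemma sphericalG_self {k c : ℝ} (hk : 1 < k) (hc : c ∈ Ioo (0 : ℝ) 1) : sphericalG k c c = 1 := by
  obtain ⟨h0, h1⟩ := hc
  have a0 : c + k / c ≠ 0 := by positivity
  have a1 : (1 + c) * (k - c) * (1 - c) * (k + c) ≠ 0 :=
    mul_ne_zero (mul_ne_zero (mul_ne_zero (by linarith) (by linarith)) (by linarith)) (by linarith)
  rw [sphericalG, div_self a0, show (1 - c) * (k + c) * (1 + c) * (k - c) =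
    (1 + c) * (k - c) * (1 - c) * (k + c) by ring, div_self a1]
  simp

lemma sphericalG_eq {k c z : ℝ} (hk : 1 < k) (hc : c ∈ Ioo (0 : ℝ) 1)
    (hz : z ∈ Ioo (-1 : ℝ) 1) :
    sphericalG k c z = (k + c ^ 2) * ((1 - c) * (k + c)) * ((1 + z) * (k - z)) /
      ((c * z + k) * legendreRoot k c * legendreRoot k z) := by
  have hc' : c ∈ Ioo (-1 : ℝ) 1 := ⟨by linarith [hc.1], hc.2⟩
  have hY := legendreRoot_pos hk hz
  have hYc := legendreRoot_pos hk hc'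
  have hY2 := legendreRoot_sq hk hz
  have hYc2 := legendreRoot_sq hk hc'
  obtain ⟨h0, h1⟩ := hc
  obtain ⟨hz0, hz1⟩ := hz
  have a1 : 0 < 1 - c := by linarith
  have a2 : 0 < k + c := by linarith
  have a3 : 0 < 1 + z := by linarith
  have a4 : 0 < k - z := by linarith
  have a5 : 0 < 1 - z := by linarith
  have a6 : 0 < k + z := by linarith
  have a7 : 0 < k - c := by linarith
  have hsq : Real.sqrt (((1 - c) * (k + c) * (1 + z) * (k - z)) /
      ((1 + c) * (k - c) * (1 - z) * (k + z))) =
      (1 - c) * (k + c) * ((1 + z) * (k - z)) / (legendreRoot k c * legendreRoot k z) := by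
    rw [Real.sqrt_eq_iff_mul_self_eq (by positivity) (by positivity), ← sq, div_pow, mul_pow,
      mul_pow (legendreRoot k c), hY2, hYc2, show (1 - z ^ 2) * (k ^ 2 - z ^ 2) =
        (1 - z) * (1 + z) * ((k - z) * (k + z)) by ring,
      show (1 - c ^ 2) * (k ^ 2 - c ^ 2) = (1 - c) * (1 + c) * ((k - c) * (k + c)) by ring]
    field_simp
  have a8 : 0 < c * z + k := by nlinarith
  have a9 : z + k / c = (c * z + k) / c := by field_simp
  rw [sphericalG, hsq, a9]
  field_simp
  ring

lemma intervalIntegrable_sphericalF_integrand {k c : ℝ} (hk : 1 < k) (hc : c ∈ Ioo (0 : ℝ) 1) :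
    IntervalIntegrable (fun z => (sphericalG k c z - 1) / (z - c)) volume (-1) 1 := by
  obtain ⟨h0, h1⟩ := hc
  let H : ℝ → ℝ := fun z => ((c + k / c) / (z + k / c)) *
      Real.sqrt (((1 - c) * (k + c) * (1 + z) * (k - z)) / ((1 + c) * (k - c) * (k + z))) -
        Real.sqrt (1 - z)
  have a1 : 0 < 1 - c := by linarith
  have a7 : 0 < k - c := by linarith
  have hkc : 1 < k / c := by rw [lt_div_iff₀ h0]; linarith
  have hG : ∀ z < 1, H z = (sphericalG k c z - 1) * Real.sqrt (1 - z) := fun z hz => by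
    have := Real.sqrt_pos.2 (sub_pos.2 hz)
    rw [sphericalG_eq_div_sqrt k c hz, sub_mul, div_mul_cancel₀ _ this.ne', one_mul]
  have hHc : H c = 0 := by rw [hG c h1, sphericalG_self hk ⟨h0, h1⟩]; simp
  have hcont : ContinuousOn H (Icc (-1) 1) := by
    refine ContinuousOn.sub (ContinuousOn.mul (ContinuousOn.div (by fun_prop) (by fun_prop)
      fun z hz => by linarith [hz.1]) (ContinuousOn.sqrt (ContinuousOn.div (by fun_prop)
      (by fun_prop) fun z hz => ?_))) (by fun_prop)
    have : 0 < k + z := by linarith [hz.1]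
    positivity
  have hdiff : DifferentiableAt ℝ H c := by
    have b1 : c + k / c ≠ 0 := by positivity
    have b2 : (1 + c) * (k - c) * (k + c) ≠ 0 := by positivity
    refine DifferentiableAt.sub (DifferentiableAt.mul (DifferentiableAt.div (by fun_prop)
      (by fun_prop) b1) (DifferentiableAt.sqrt (DifferentiableAt.div (by fun_prop)
      (by fun_prop) b2) ?_)) (DifferentiableAt.sqrt (by fun_prop) a1.ne')
    positivity
  have hds := (continuousOn_dslope (Icc_mem_nhds (by linarith) h1)).2 ⟨hcont, hdiff⟩
  refine (intervalIntegrable_div_sqrt_one_sub (by norm_num) hds).congr_ae ?_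
  rw [Filter.EventuallyEq, ae_restrict_iff' measurableSet_uIoc]
  filter_upwards [volume.ae_ne c, volume.ae_ne 1] with z hzc hz1 hz
  rw [uIoc_of_le (by norm_num)] at hz
  have hz' : z < 1 := lt_of_le_of_ne hz.2 hz1
  have := Real.sqrt_pos.2 (sub_pos.2 hz')
  rw [dslope_of_ne _ hzc, slope_def_field, hHc, sub_zero, hG z hz']
  field_simp

/-- A primitive of the difference between the symmetrized integrand of `sphericalF` and its
nonsingular part. -/
noncomputable def regularizingPrimitive (k c z : ℝ) : ℝ :=
  2 * Real.log (z + c) + Real.log (k ^ 2 - c ^ 2 * z ^ 2) -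
    2 * Real.log (c * legendreRoot k z + z * legendreRoot k c)

lemma regularizingPrimitive_zero {k c : ℝ} (hk : 1 < k) (hc : 0 < c) :
    regularizingPrimitive k c 0 = 0 := by
  have : legendreRoot k 0 = k := by
    simp [legendreRoot, Real.sqrt_sq (by linarith : (0 : ℝ) ≤ k)]
  simp [regularizingPrimitive, this, Real.log_mul hc.ne' (by linarith : k ≠ 0)]
  ring

lemma regularizingPrimitive_one {k c : ℝ} (hk : 1 < k) (hc : c ∈ Ioo (0 : ℝ) 1) :
    regularizingPrimitive k c 1 = -Real.log ((1 - c) / (1 + c)) := by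
  have h1 : legendreRoot k 1 = 0 := by simp [legendreRoot]
  have hc' : c ∈ Ioo (-1 : ℝ) 1 := ⟨by linarith [hc.1], hc.2⟩
  have hd : k ^ 2 - c ^ 2 ≠ 0 := by nlinarith [hc.1, hc.2]
  have h2 : 2 * Real.log (legendreRoot k c) =
      Real.log (1 - c) + Real.log (1 + c) + Real.log (k ^ 2 - c ^ 2) := by
    have : 2 * Real.log (legendreRoot k c) = Real.log (legendreRoot k c ^ 2) := by
      rw [Real.log_pow]; norm_num
    rw [this, legendreRoot_sq hk hc', Real.log_mul (by nlinarith [hc.1, hc.2]) hd,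
      show 1 - c ^ 2 = (1 - c) * (1 + c) by ring,
      Real.log_mul (by linarith [hc.2]) (by linarith [hc.1])]
  rw [Real.log_div (by linarith [hc.2]) (by linarith [hc.1])]
  simp only [regularizingPrimitive, h1, mul_zero, zero_add, one_mul, one_pow, mul_one, h2]
  ring

lemma regularizing_denominator_pos {k c z : ℝ} (hk : 1 < k) (hc : c ∈ Ioo (0 : ℝ) 1)
    (hz : z ∈ Icc (0 : ℝ) 1) : 0 < c * legendreRoot k z + z * legendreRoot k c := by
  have hYc := legendreRoot_pos hk (z := c) ⟨by linarith [hc.1], hc.2⟩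
  have hY : 0 ≤ legendreRoot k z := Real.sqrt_nonneg _
  have h0 := hc.1
  rcases hz.1.eq_or_lt with rfl | h
  · have := legendreRoot_pos hk (z := 0) ⟨by norm_num, by norm_num⟩
    positivity
  · positivity

lemma continuousOn_regularizingPrimitive {k c : ℝ} (hk : 1 < k) (hc : c ∈ Ioo (0 : ℝ) 1) :
    ContinuousOn (regularizingPrimitive k c) (Icc 0 1) := by
  have := continuous_legendreRoot k
  refine ContinuousOn.sub (ContinuousOn.add (continuousOn_const.mul
    (ContinuousOn.log (by fun_prop) fun z hz => ?_)) (ContinuousOn.log (by fun_prop) fun z hz => ?_))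
    (continuousOn_const.mul (ContinuousOn.log (by fun_prop) fun z hz => ?_))
  · linarith [hz.1, hc.1]
  · exact (kernel_denominator_pos hk hc hz).ne'
  · exact (regularizing_denominator_pos hk hc hz).ne'

lemma hasDerivAt_regularizingPrimitive {k c z : ℝ} (hk : 1 < k) (hc : c ∈ Ioo (0 : ℝ) 1)
    (hz : z ∈ Ioo (0 : ℝ) 1) :
    HasDerivAt (regularizingPrimitive k c)
      (2 / (z + c) - 2 * c ^ 2 * z / (k ^ 2 - c ^ 2 * z ^ 2) -
        2 * ((c * (-(z * (k ^ 2 + 1 - 2 * z ^ 2)) / legendreRoot k z) + legendreRoot k c) /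
          (c * legendreRoot k z + z * legendreRoot k c))) z := by
  have hz' := Ioo_subset_Icc_self hz
  have h0 : HasDerivAt (fun x : ℝ => x ^ 2) (2 * z) z := by simpa using hasDerivAt_pow 2 z
  have hr := hasDerivAt_legendreRoot hk (z := z) ⟨by linarith [hz.1], hz.2⟩
  have e1 := (((hasDerivAt_id z).add_const c).log
    (by simp only [id]; linarith [hz.1, hc.1])).const_mul 2
  have e2 := ((h0.const_mul (c ^ 2)).const_sub (k ^ 2)).log (kernel_denominator_pos hk hc hz').ne'
  have e3 := (((hr.const_mul c).add ((hasDerivAt_id z).mul_const (legendreRoot k c))).log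
    (regularizing_denominator_pos hk hc hz').ne').const_mul 2
  refine ((e1.add e2).sub e3).congr_deriv ?_
  simp only [id, Pi.add_apply, one_mul]
  ring

/-- The symmetrized integrand of `sphericalF` splits into a multiple of the nonsingular kernel and
the derivative of `regularizingPrimitive`. -/
lemma sphericalF_integrand_add_neg {k c z : ℝ} (hk : 1 < k) (hc : c ∈ Ioo (0 : ℝ) 1)
    (hz : z ∈ Ioo (0 : ℝ) 1) (hzc : z ≠ c) :
    (sphericalG k c z - 1) / (z - c) + (sphericalG k c (-z) - 1) / (-z - c) -
      2 * legendreRoot k c / c * (sphericalKernel k c z / legendreRoot k z) =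
      2 / (z + c) - 2 * c ^ 2 * z / (k ^ 2 - c ^ 2 * z ^ 2) -
        2 * ((c * (-(z * (k ^ 2 + 1 - 2 * z ^ 2)) / legendreRoot k z) + legendreRoot k c) /
          (c * legendreRoot k z + z * legendreRoot k c)) := by
  have hz' : z ∈ Ioo (-1 : ℝ) 1 := ⟨by linarith [hz.1], hz.2⟩
  have hc' : c ∈ Ioo (-1 : ℝ) 1 := ⟨by linarith [hc.1], hc.2⟩
  have hnz : -z ∈ Ioo (-1 : ℝ) 1 := ⟨by linarith [hz.2], by linarith [hz.1]⟩
  have hY := legendreRoot_pos hk hz'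
  have hYc := legendreRoot_pos hk hc'
  have hY2 := legendreRoot_sq hk hz'
  have hYc2 := legendreRoot_sq hk hc'
  have hden := regularizing_denominator_pos hk hc (Ioo_subset_Icc_self hz)
  have hD := kernel_denominator_pos hk hc (Ioo_subset_Icc_self hz)
  rw [sphericalG_eq hk hc hz', sphericalG_eq hk hc hnz, legendreRoot_neg, sphericalKernel]
  generalize legendreRoot k z = Y at *
  generalize legendreRoot k c = Yc at *
  obtain ⟨h0, h1⟩ := hc
  obtain ⟨hz0, hz1⟩ := hz
  have b1 : z - c ≠ 0 := sub_ne_zero.2 hzc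
  have b2 : z + c ≠ 0 := by linarith
  have b4 : c * z + k ≠ 0 := by nlinarith
  have b5 : k - c * z ≠ 0 := by nlinarith
  have b6 : 1 - c ≠ 0 := by linarith
  have b7 : 1 + c ≠ 0 := by linarith
  have b8 : k - c ≠ 0 := by linarith
  have b9 : k + c ≠ 0 := by linarith
  have hquot : (c * (-(z * (k ^ 2 + 1 - 2 * z ^ 2)) / Y) + Yc) / (c * Y + z * Yc) =
      c * (k ^ 2 - z ^ 4) / ((c ^ 2 - z ^ 2) * (k ^ 2 - c ^ 2 * z ^ 2)) * (Yc / Y) -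
      (c ^ 2 * z * (k ^ 2 + 1 - 2 * z ^ 2) + z * ((1 - c ^ 2) * (k ^ 2 - c ^ 2))) /
        ((c ^ 2 - z ^ 2) * (k ^ 2 - c ^ 2 * z ^ 2)) := by
    have hprod : (c * Y + z * Yc) * (c * Y - z * Yc) =
        (c ^ 2 - z ^ 2) * (k ^ 2 - c ^ 2 * z ^ 2) := by
      linear_combination c ^ 2 * hY2 - z ^ 2 * hYc2
    have hcz : c ^ 2 - z ^ 2 ≠ 0 := by
      rw [show c ^ 2 - z ^ 2 = -((z - c) * (z + c)) by ring]
      exact neg_ne_zero.2 (mul_ne_zero b1 b2)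
    have hne : (c ^ 2 - z ^ 2) * (k ^ 2 - c ^ 2 * z ^ 2) ≠ 0 := mul_ne_zero hcz hD.ne'
    have hdiff : c * Y - z * Yc ≠ 0 := fun h => hne (by rw [← hprod, h, mul_zero])
    rw [← mul_div_mul_right _ _ hdiff, hprod]
    field_simp
    linear_combination c * Yc * hY2 - z * Y * hYc2
  have hroot : ∀ x w : ℝ, x / (w * Yc * Y) =
      x / (w * ((1 - c ^ 2) * (k ^ 2 - c ^ 2))) * (Yc / Y) := by
    intro x w
    rw [← hYc2]
    field_simp
  rw [hquot, hroot, hroot]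
  have hA : (k + c ^ 2) * ((1 - c) * (k + c)) * ((1 + z) * (k - z)) /
        ((c * z + k) * ((1 - c ^ 2) * (k ^ 2 - c ^ 2))) / (z - c) +
      (k + c ^ 2) * ((1 - c) * (k + c)) * ((1 + -z) * (k - -z)) /
        ((c * -z + k) * ((1 - c ^ 2) * (k ^ 2 - c ^ 2))) / (-z - c) =
      2 / c * ((k ^ 2 + c ^ 2 * z ^ 2) / (k ^ 2 - c ^ 2 * z ^ 2) -
        (k + c ^ 2) / ((1 + c) * (k - c))) -
      2 * (c * (k ^ 2 - z ^ 4) / ((c ^ 2 - z ^ 2) * (k ^ 2 - c ^ 2 * z ^ 2))) := by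
    rw [show 1 - c ^ 2 = (1 - c) * (1 + c) by ring,
      show k ^ 2 - c ^ 2 = (k - c) * (k + c) by ring,
      show k ^ 2 - c ^ 2 * z ^ 2 = (c * z + k) * (k - c * z) by ring,
      show c * -z + k = k - c * z by ring, show -z - c = -(z + c) by ring,
      show c ^ 2 - z ^ 2 = -((z - c) * (z + c)) by ring]
    field_simp
    ring
  have hB : -1 / (z - c) + -1 / (-z - c) = 2 / (z + c) -
      2 * c ^ 2 * z / (k ^ 2 - c ^ 2 * z ^ 2) +
      2 * ((c ^ 2 * z * (k ^ 2 + 1 - 2 * z ^ 2) + z * ((1 - c ^ 2) * (k ^ 2 - c ^ 2))) /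
        ((c ^ 2 - z ^ 2) * (k ^ 2 - c ^ 2 * z ^ 2))) := by
    rw [show -z - c = -(z + c) by ring, show c ^ 2 - z ^ 2 = -((z - c) * (z + c)) by ring,
      show k ^ 2 - c ^ 2 * z ^ 2 = (z * c + k) * (k - z * c) by ring]
    rw [mul_comm c z] at b4 b5
    field_simp
    ring
  linear_combination (Yc / Y) * hA + hB

lemma sphericalF_eq {k c : ℝ} (hk : 1 < k) (hc : c ∈ Ioo (0 : ℝ) 1) :
    sphericalF k c = 2 * legendreRoot k c / c *
      ∫ z in (0 : ℝ)..1, sphericalKernel k c z / legendreRoot k z := by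
  have hI := intervalIntegrable_sphericalF_integrand hk hc
  have hneg : IntervalIntegrable (fun z => (sphericalG k c z - 1) / (z - c)) volume (-1) 0 :=
    hI.mono_set (by
      rw [uIcc_of_le (by norm_num), uIcc_of_le (by norm_num)]
      exact Icc_subset_Icc_right zero_le_one)
  have hpos : IntervalIntegrable (fun z => (sphericalG k c z - 1) / (z - c)) volume 0 1 :=
    hI.mono_set (by
      rw [uIcc_of_le (by norm_num), uIcc_of_le (by norm_num)]
      exact Icc_subset_Icc_left (by norm_num))
  have hneg' : IntervalIntegrable (fun z => (sphericalG k c (-z) - 1) / (-z - c)) volume 0 1 := by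
    have := (IntervalIntegrable.iff_comp_neg (f := fun z => (sphericalG k c z - 1) / (z - c))).1 hneg
    simpa using this.symm
  have hK := (intervalIntegrable_sphericalKernel hk hc).const_mul (2 * legendreRoot k c / c)
  have hae : ∀ᵐ z : ℝ, z ∈ uIoc (0 : ℝ) 1 →
      (sphericalG k c z - 1) / (z - c) + (sphericalG k c (-z) - 1) / (-z - c) -
        2 * legendreRoot k c / c * (sphericalKernel k c z / legendreRoot k z) =
      2 / (z + c) - 2 * c ^ 2 * z / (k ^ 2 - c ^ 2 * z ^ 2) -
        2 * ((c * (-(z * (k ^ 2 + 1 - 2 * z ^ 2)) / legendreRoot k z) + legendreRoot k c) /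
          (c * legendreRoot k z + z * legendreRoot k c)) := by
    filter_upwards [volume.ae_ne c, volume.ae_ne 1] with z hzc hz1 hz
    rw [uIoc_of_le zero_le_one] at hz
    exact sphericalF_integrand_add_neg hk hc ⟨hz.1, lt_of_le_of_ne hz.2 hz1⟩ hzc
  have hL := integral_eq_sub_of_hasDerivAt_of_le zero_le_one
    (continuousOn_regularizingPrimitive hk hc)
    (fun z hz => hasDerivAt_regularizingPrimitive hk hc hz)
    (((hpos.add hneg').sub hK).congr_ae
      ((ae_restrict_iff' measurableSet_uIoc).2 hae))
  rw [← integral_congr_ae hae, integral_sub (hpos.add hneg') hK, integral_add hpos hneg',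
    regularizingPrimitive_zero hk hc.1, regularizingPrimitive_one hk hc,
    intervalIntegral.integral_const_mul,
    integral_comp_neg (fun z => (sphericalG k c z - 1) / (z - c)), neg_zero] at hL
  rw [sphericalF, ← integral_add_adjacent_intervals hneg hpos]
  linarith

/-- For every k > 1 there is at most one c ∈ (0,1) with F(k,c) = 0. -/
theorem sphericalF_zero_unique (k : ℝ) (hk : 1 < k) :
    ∀ c₁ ∈ Set.Ioo (0 : ℝ) 1, ∀ c₂ ∈ Set.Ioo (0 : ℝ) 1,
      sphericalF k c₁ = 0 → sphericalF k c₂ = 0 → c₁ = c₂ := by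
  have key : ∀ c ∈ Ioo (0 : ℝ) 1, sphericalF k c = 0 →
      ∫ z in (0 : ℝ)..1, sphericalKernel k c z / legendreRoot k z = 0 := by
    intro c hc h
    have hYc := legendreRoot_pos hk (z := c) ⟨by linarith [hc.1], hc.2⟩
    have h0 := hc.1
    rw [sphericalF_eq hk hc] at h
    exact (mul_eq_zero.1 h).resolve_left (by positivity)
  intro c₁ hc₁ c₂ hc₂ h₁ h₂
  have i₁ := key c₁ hc₁ h₁
  have i₂ := key c₂ hc₂ h₂
  exact le_antisymm (not_lt.1 (not_lt_of_integral_sphericalKernel_eq_zero hk hc₂ hc₁ i₂ i₁))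
    (not_lt.1 (not_lt_of_integral_sphericalKernel_eq_zero hk hc₁ hc₂ i₁ i₂))
end

section
/- There exists a unique m ∈ (0, 1) such that ∫₀¹ dx/√((1−x²)(1−m²x²)) = 2·∫₀¹ √((1−m²x²)/(1−x²)) dx, i.e. such that K(m) − 2E(m) = 0, where K and E denote the complete elliptic integrals of the first and second kind. -/
open Set Filter Topology MeasureTheory

theorem intervalIntegrable_inv_sqrt_one_sub_sq :
    IntervalIntegrable (fun x : ℝ => 1 / √(1 - x ^ 2)) volume 0 1 := by
  refine intervalIntegral.intervalIntegrable_deriv_of_nonneg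
    (g := Real.arcsin) Real.continuous_arcsin.continuousOn ?_ ?_
  · intro x hx
    rw [min_eq_left zero_le_one, max_eq_right zero_le_one] at hx
    exact Real.hasDerivAt_arcsin (by linarith [hx.1]) (by linarith [hx.2])
  · intro x _
    positivity

theorem one_sub_sq_mul_sq_pos {m x : ℝ} (hm : m ∈ Ico (0 : ℝ) 1) (hx : x ∈ Icc (0 : ℝ) 1) :
    0 < 1 - m ^ 2 * x ^ 2 := by
  have h : m * x < 1 := by nlinarith [hm.1, hm.2, hx.1, hx.2]
  nlinarith [mul_nonneg hm.1 hx.1]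

/-- The integrand of `2 E(m) - K(m)`. -/
noncomputable def koppenfelsIntegrand (m x : ℝ) : ℝ :=
  1 / √(1 - x ^ 2) * (2 * √(1 - m ^ 2 * x ^ 2) - 1 / √(1 - m ^ 2 * x ^ 2))

theorem intervalIntegrable_inv_sqrt_mul {f : ℝ → ℝ} (hf : ContinuousOn f (Icc 0 1)) :
    IntervalIntegrable (fun x : ℝ => 1 / √(1 - x ^ 2) * f x) volume 0 1 :=
  intervalIntegrable_inv_sqrt_one_sub_sq.mul_continuousOn (by rwa [uIcc_of_le zero_le_one])

theorem continuousOn_inv_sqrt {m : ℝ} (hm : m ∈ Ico (0 : ℝ) 1) :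
    ContinuousOn (fun x : ℝ => 1 / √(1 - m ^ 2 * x ^ 2)) (Icc 0 1) :=
  continuousOn_const.div (by fun_prop)
    fun _ hx => (Real.sqrt_pos.2 (one_sub_sq_mul_sq_pos hm hx)).ne'

theorem intervalIntegrable_koppenfelsIntegrand {m : ℝ} (hm : m ∈ Ico (0 : ℝ) 1) :
    IntervalIntegrable (koppenfelsIntegrand m) volume 0 1 :=
  intervalIntegrable_inv_sqrt_mul
    (ContinuousOn.sub (by fun_prop) (continuousOn_inv_sqrt hm))

theorem integral_koppenfelsIntegrand {m : ℝ} (hm : m ∈ Ico (0 : ℝ) 1) :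
    ∫ x in (0 : ℝ)..1, koppenfelsIntegrand m x =
      2 * (∫ x in (0 : ℝ)..1, √((1 - m ^ 2 * x ^ 2) / (1 - x ^ 2))) -
        ∫ x in (0 : ℝ)..1, 1 / √((1 - x ^ 2) * (1 - m ^ 2 * x ^ 2)) := by
  have hE : ∫ x in (0 : ℝ)..1, √((1 - m ^ 2 * x ^ 2) / (1 - x ^ 2)) =
      ∫ x in (0 : ℝ)..1, 1 / √(1 - x ^ 2) * √(1 - m ^ 2 * x ^ 2) := by
    refine intervalIntegral.integral_congr fun x hx => ?_
    rw [uIcc_of_le zero_le_one] at hx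
    rw [Real.sqrt_div (one_sub_sq_mul_sq_pos hm hx).le]
    ring
  have hK : ∫ x in (0 : ℝ)..1, 1 / √((1 - x ^ 2) * (1 - m ^ 2 * x ^ 2)) =
      ∫ x in (0 : ℝ)..1, 1 / √(1 - x ^ 2) * (1 / √(1 - m ^ 2 * x ^ 2)) := by
    refine intervalIntegral.integral_congr fun x hx => ?_
    rw [uIcc_of_le zero_le_one] at hx
    rw [Real.sqrt_mul' _ (one_sub_sq_mul_sq_pos hm hx).le, one_div_mul_one_div]
  rw [hE, hK, ← intervalIntegral.integral_const_mul, ← intervalIntegral.integral_sub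
    ((intervalIntegrable_inv_sqrt_mul (by fun_prop)).const_mul 2)
    (intervalIntegrable_inv_sqrt_mul (continuousOn_inv_sqrt hm))]
  refine intervalIntegral.integral_congr fun x _ => ?_
  simp only [koppenfelsIntegrand]
  ring

theorem strictAntiOn_integral_koppenfelsIntegrand :
    StrictAntiOn (fun m : ℝ => ∫ x in (0 : ℝ)..1, koppenfelsIntegrand m x) (Ico 0 1) := by
  intro m hm n hn hmn
  have hi := intervalIntegrable_koppenfelsIntegrand hm
  have hj := intervalIntegrable_koppenfelsIntegrand hn
  simp only
  rw [← sub_pos, ← intervalIntegral.integral_sub hi hj]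
  refine intervalIntegral.intervalIntegral_pos_of_pos_on (hi.sub hj) (fun x hx => ?_) one_pos
  have hpos := one_sub_sq_mul_sq_pos hn (Ioo_subset_Icc_self hx)
  have hlt : √(1 - n ^ 2 * x ^ 2) < √(1 - m ^ 2 * x ^ 2) := by
    have : m ^ 2 < n ^ 2 := by nlinarith [hm.1]
    have : m ^ 2 * x ^ 2 < n ^ 2 * x ^ 2 := mul_lt_mul_of_pos_right this (pow_pos hx.1 2)
    exact Real.sqrt_lt_sqrt hpos.le (by linarith)
  have hinv := one_div_lt_one_div_of_lt (Real.sqrt_pos.2 hpos) hlt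
  have hw : 0 < 1 / √(1 - x ^ 2) :=
    one_div_pos.2 (Real.sqrt_pos.2 (by nlinarith [hx.1, hx.2]))
  simp only [koppenfelsIntegrand]
  rw [sub_pos]
  exact mul_lt_mul_of_pos_left (by linarith) hw

theorem continuousOn_integral_koppenfelsIntegrand {b : ℝ} (hb : b < 1) :
    ContinuousOn (fun m : ℝ => ∫ x in (0 : ℝ)..1, koppenfelsIntegrand m x) (Icc 0 b) := by
  intro m hm
  have hIco : ∀ n ∈ Icc 0 b, n ∈ Ico (0 : ℝ) 1 := fun n hn => ⟨hn.1, hn.2.trans_lt hb⟩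
  have hbI := hIco b ⟨hm.1.trans hm.2, le_rfl⟩
  refine intervalIntegral.continuousWithinAt_of_dominated_interval
    (bound := fun x => 1 / √(1 - x ^ 2) * (2 + 1 / √(1 - b ^ 2 * x ^ 2))) ?_ ?_
    (intervalIntegrable_inv_sqrt_mul (continuousOn_const.add (continuousOn_inv_sqrt hbI))) ?_
  · filter_upwards [self_mem_nhdsWithin] with n hn
    rw [uIoc_of_le zero_le_one]
    exact (intervalIntegrable_koppenfelsIntegrand (hIco n hn)).1.aestronglyMeasurable
  · filter_upwards [self_mem_nhdsWithin] with n hn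
    refine Eventually.of_forall fun x hx => ?_
    rw [uIoc_of_le zero_le_one] at hx
    have hx := Ioc_subset_Icc_self hx
    have hpos := one_sub_sq_mul_sq_pos hbI hx
    have hle : 1 - b ^ 2 * x ^ 2 ≤ 1 - n ^ 2 * x ^ 2 := by
      have : n ^ 2 ≤ b ^ 2 := pow_le_pow_left₀ hn.1 hn.2 2
      nlinarith [sq_nonneg x]
    have hinv := one_div_le_one_div_of_le (Real.sqrt_pos.2 hpos) (Real.sqrt_le_sqrt hle)
    have h1 : √(1 - n ^ 2 * x ^ 2) ≤ 1 := Real.sqrt_le_one.2 (by nlinarith [sq_nonneg (n * x)])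
    have h0 := Real.sqrt_nonneg (1 - n ^ 2 * x ^ 2)
    have h2 : 0 ≤ 1 / √(1 - n ^ 2 * x ^ 2) := by positivity
    rw [koppenfelsIntegrand, norm_mul, Real.norm_of_nonneg (by positivity : 0 ≤ 1 / √(1 - x ^ 2))]
    refine mul_le_mul_of_nonneg_left ?_ (by positivity)
    rw [Real.norm_eq_abs, abs_le]
    constructor <;> linarith
  · refine Eventually.of_forall fun x hx => ?_
    rw [uIoc_of_le zero_le_one] at hx
    have hne := (Real.sqrt_pos.2 (one_sub_sq_mul_sq_pos (hIco m hm) (Ioc_subset_Icc_self hx))).ne'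
    have hc : ContinuousAt (fun n : ℝ => √(1 - n ^ 2 * x ^ 2)) m := by fun_prop
    exact (continuousAt_const.mul
      ((continuousAt_const.mul hc).sub (continuousAt_const.div hc hne))).continuousWithinAt

theorem integral_koppenfelsIntegrand_zero_pos :
    0 < ∫ x in (0 : ℝ)..1, koppenfelsIntegrand 0 x := by
  refine intervalIntegral.intervalIntegral_pos_of_pos_on
    (intervalIntegrable_koppenfelsIntegrand ⟨le_rfl, one_pos⟩) (fun x hx => ?_) one_pos
  have : 0 < √(1 - x ^ 2) := Real.sqrt_pos.2 (by nlinarith [hx.1, hx.2])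
  have h : koppenfelsIntegrand 0 x = 1 / √(1 - x ^ 2) := by norm_num [koppenfelsIntegrand]
  rw [h]
  positivity

theorem koppenfelsIntegrand_le {m k x : ℝ} (hm : m ∈ Ico (0 : ℝ) 1) (hk : 0 ≤ k)
    (hmk : 1 - m ^ 2 ≤ k ^ 2) (hx : x ∈ Ioo (0 : ℝ) 1) :
    koppenfelsIntegrand m x ≤ 2 + 2 * k * (x / √(1 - x ^ 2)) - 1 / (1 - m ^ 2 * x ^ 2) := by
  have hpos := one_sub_sq_mul_sq_pos hm (Ioo_subset_Icc_self hx)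
  have hx1 : 0 < 1 - x ^ 2 := by nlinarith [hx.1, hx.2]
  have hm1 : m ^ 2 ≤ 1 := by nlinarith [hm.1, hm.2]
  have hs := Real.sqrt_pos.2 hx1
  have ha := Real.sqrt_pos.2 hpos
  have hsa : √(1 - x ^ 2) ≤ √(1 - m ^ 2 * x ^ 2) :=
    Real.sqrt_le_sqrt (by nlinarith [sq_nonneg x])
  have has : √(1 - m ^ 2 * x ^ 2) ≤ √(1 - x ^ 2) + k * x := by
    have hkx := mul_nonneg hk hx.1.le
    refine Real.sqrt_le_iff.2 ⟨by positivity, ?_⟩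
    nlinarith [Real.sq_sqrt hx1.le, mul_nonneg hs.le hkx,
      mul_le_mul_of_nonneg_right hmk (sq_nonneg x)]
  have h1 : √(1 - m ^ 2 * x ^ 2) / √(1 - x ^ 2) ≤ 1 + k * (x / √(1 - x ^ 2)) := by
    rw [div_le_iff₀ hs]
    field_simp
    linarith
  have h2 : 1 / (1 - m ^ 2 * x ^ 2) ≤ 1 / (√(1 - x ^ 2) * √(1 - m ^ 2 * x ^ 2)) := by
    refine one_div_le_one_div_of_le (by positivity) ?_
    nlinarith [Real.mul_self_sqrt hpos.le]
  calc koppenfelsIntegrand m x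
      = 2 * (√(1 - m ^ 2 * x ^ 2) / √(1 - x ^ 2))
        - 1 / (√(1 - x ^ 2) * √(1 - m ^ 2 * x ^ 2)) := by
        rw [koppenfelsIntegrand, ← one_div_mul_one_div]
        ring
    _ ≤ _ := by linarith

theorem integral_koppenfelsIntegrand_le {m k : ℝ} (hm : m ∈ Ioo (0 : ℝ) 1) (hk : 0 ≤ k)
    (hmk : 1 - m ^ 2 ≤ k ^ 2) :
    ∫ x in (0 : ℝ)..1, koppenfelsIntegrand m x ≤
      2 + 2 * k - (Real.log (1 + m) - Real.log (1 - m)) / (2 * m) := by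
  have hmI : m ∈ Ico (0 : ℝ) 1 := Ioo_subset_Ico_self hm
  have hpos : ∀ x ∈ Icc (0 : ℝ) 1, 0 < 1 + m * x ∧ 0 < 1 - m * x := fun x hx =>
    ⟨by nlinarith [hm.1, hx.1], by nlinarith [hm.1, hm.2, hx.1, hx.2]⟩
  have key := intervalIntegral.integral_le_sub_of_hasDeriv_right_of_le zero_le_one
    (g := fun x => 2 * x - 2 * k * √(1 - x ^ 2)
      - (Real.log (1 + m * x) - Real.log (1 - m * x)) / (2 * m))
    (g' := fun x => 2 + 2 * k * (x / √(1 - x ^ 2)) - 1 / (1 - m ^ 2 * x ^ 2))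
    (φ := koppenfelsIntegrand m) ?_ ?_
    ((intervalIntegrable_iff_integrableOn_Icc_of_le zero_le_one).1
      (intervalIntegrable_koppenfelsIntegrand hmI))
    (fun x hx => koppenfelsIntegrand_le hmI hk hmk hx)
  · refine key.trans (le_of_eq ?_)
    norm_num
    ring
  · refine ContinuousOn.sub (by fun_prop) (ContinuousOn.div_const (ContinuousOn.sub ?_ ?_) _)
    · exact ContinuousOn.log (by fun_prop) fun x hx => (hpos x hx).1.ne'
    · exact ContinuousOn.log (by fun_prop) fun x hx => (hpos x hx).2.ne'
  · intro x hx
    have hp := hpos x (Ioo_subset_Icc_self hx)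
    have hx1 : 0 < 1 - x ^ 2 := by nlinarith [hx.1, hx.2]
    have hs := Real.sqrt_pos.2 hx1
    have d1 : HasDerivAt (fun x : ℝ => 1 + m * x) (m * 1) x :=
      ((hasDerivAt_id x).const_mul m).const_add 1
    have d2 : HasDerivAt (fun x : ℝ => 1 - m * x) (-(m * 1)) x :=
      ((hasDerivAt_id x).const_mul m).const_sub 1
    have d3 : HasDerivAt (fun x : ℝ => √(1 - x ^ 2)) _ x :=
      ((hasDerivAt_pow 2 x).const_sub 1).sqrt hx1.ne'
    have d := (((hasDerivAt_id x).const_mul 2).sub (d3.const_mul (2 * k))).sub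
      (((d1.log hp.1.ne').sub (d2.log hp.2.ne')).div_const (2 * m))
    refine (d.congr_deriv ?_).hasDerivWithinAt
    have hm0 := hm.1.ne'
    have hlog : (m * 1 / (1 + m * x) - -(m * 1) / (1 - m * x)) / (2 * m)
        = 1 / (1 - m ^ 2 * x ^ 2) := by
      have hne := (one_sub_sq_mul_sq_pos hmI (Ioo_subset_Icc_self hx)).ne'
      rw [div_sub_div _ _ hp.1.ne' hp.2.ne', div_div, div_eq_div_iff (mul_ne_zero
        (mul_ne_zero hp.1.ne' hp.2.ne') (mul_ne_zero two_ne_zero hm0)) hne]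
      ring
    rw [hlog]
    field_simp
    ring

theorem exists_integral_koppenfelsIntegrand_neg :
    ∃ m ∈ Ioo (0 : ℝ) 1, ∫ x in (0 : ℝ)..1, koppenfelsIntegrand m x < 0 := by
  have hm : (999 / 1000 : ℝ) ∈ Ioo (0 : ℝ) 1 := by constructor <;> norm_num
  refine ⟨_, hm, (integral_koppenfelsIntegrand_le hm (k := 1 / 20)
    (by norm_num) (by norm_num)).trans_lt ?_⟩
  have hlog : 10 * Real.log 2 ≤ Real.log (1 + 999 / 1000) - Real.log (1 - 999 / 1000) := by
    rw [← Real.log_div (by norm_num) (by norm_num), ← Real.log_rpow two_pos]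
    exact Real.log_le_log (by positivity) (by norm_num)
  rw [sub_neg, lt_div_iff₀ (by norm_num)]
  linarith [Real.log_two_gt_d9]


/-- Von Koppenfels' equation K(m) − 2E(m) = 0, with the complete elliptic integrals
K(m) = ∫₀¹ dx/√((1−x²)(1−m²x²)) and E(m) = ∫₀¹ √((1−m²x²)/(1−x²)) dx,
has a unique solution m ∈ (0,1). -/
theorem vonKoppenfels_unique_root :
    ∃! m : ℝ, m ∈ Set.Ioo (0 : ℝ) 1 ∧
      (∫ x in (0 : ℝ)..1, 1 / Real.sqrt ((1 - x ^ 2) * (1 - m ^ 2 * x ^ 2)))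
        = 2 * ∫ x in (0 : ℝ)..1, Real.sqrt ((1 - m ^ 2 * x ^ 2) / (1 - x ^ 2)) := by
  have hiff : ∀ m ∈ Ioo (0 : ℝ) 1,
      ((∫ x in (0 : ℝ)..1, 1 / √((1 - x ^ 2) * (1 - m ^ 2 * x ^ 2)))
        = 2 * ∫ x in (0 : ℝ)..1, √((1 - m ^ 2 * x ^ 2) / (1 - x ^ 2))) ↔
      ∫ x in (0 : ℝ)..1, koppenfelsIntegrand m x = 0 := fun m hm => by
    rw [integral_koppenfelsIntegrand (Ioo_subset_Ico_self hm), sub_eq_zero, eq_comm]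
  obtain ⟨b, hb, hneg⟩ := exists_integral_koppenfelsIntegrand_neg
  obtain ⟨m, hm, hroot⟩ := intermediate_value_Ioo' hb.1.le
    (continuousOn_integral_koppenfelsIntegrand hb.2)
    ⟨hneg, integral_koppenfelsIntegrand_zero_pos⟩
  have hmI : m ∈ Ioo (0 : ℝ) 1 := ⟨hm.1, hm.2.trans hb.2⟩
  refine ⟨m, ⟨hmI, (hiff m hmI).2 hroot⟩, ?_⟩
  rintro n ⟨hn, hn0⟩
  exact strictAntiOn_integral_koppenfelsIntegrand.injOn (Ioo_subset_Ico_self hn)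
    (Ioo_subset_Ico_self hmI) (((hiff n hn).1 hn0).trans hroot.symm)
end
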